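/- Under assumptions A1 (stochasticity) and A2 (self-confidence with constant η ∈ (0,1)), the discrete-time belief evolution achieves global ε-agreement if the persistent graph G^p is quasi-strongly connected and there exist a constant a* > 0 and an integer T* ≥ 1 such that ∑_{s=t}^{t+T*-1} W_ij(s) ≥ a* for every t ∈ ℕ and every persistent arc (j,i) of G^p. -/

import Mathlib

open Filter Finset

/-- `ReachIn R k i j`: `j` can be reached from `i` in exactly `k` steps following relation `R`. -/
def ReachIn {α : Type*} (R : α → α → Prop) : ℕ → α → α → Prop
  | 0 => fun i j => i = j
  | k + 1 => fun i j => ∃ m, R i m ∧ ReachIn R k m j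

/-- Distance from `i` to `j`: length of a shortest directed path. -/
noncomputable def distR {α : Type*} (R : α → α → Prop) (i j : α) : ℕ :=
  sInf {k | ReachIn R k i j}

/-- Diameter: maximum of `distR i j` over pairs with `j` reachable from `i`. -/
noncomputable def diamR {α : Type*} (R : α → α → Prop) : ℕ :=
  sSup {d | ∃ i j, (∃ k, ReachIn R k i j) ∧ d = distR R i j}

/-- Discrete-time belief evolution trajectory starting at time `t0`. -/
def DTraj (n : ℕ) (W : ℕ → Fin n → Fin n → ℝ) (t0 : ℕ) (x : ℕ → Fin n → ℝ) : Prop :=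
  ∀ t, t0 ≤ t → ∀ i, x (t + 1) i = ∑ j, W t i j * x t j

/-- Maximum state Ψ(t). -/
noncomputable def dMax (n : ℕ) (x : ℕ → Fin n → ℝ) (t : ℕ) : ℝ := ⨆ i, x t i

/-- Minimum state ψ(t). -/
noncomputable def dMin (n : ℕ) (x : ℕ → Fin n → ℝ) (t : ℕ) : ℝ := ⨅ i, x t i

/-- Agreement measure H(t) = Ψ(t) − ψ(t). -/
noncomputable def dH (n : ℕ) (x : ℕ → Fin n → ℝ) (t : ℕ) : ℝ := dMax n x t - dMin n x t

/-- `(j,i)` is a persistent arc: `j ≠ i` and `∑_{t=0}^∞ W_ij(t) = ∞`. -/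
def DPersistent (n : ℕ) (W : ℕ → Fin n → Fin n → ℝ) (j i : Fin n) : Prop :=
  j ≠ i ∧ Tendsto (fun T => ∑ t ∈ Finset.range T, W t i j) atTop atTop

/-- The persistent graph is quasi-strongly connected: it has a center. -/
def DQSC (n : ℕ) (W : ℕ → Fin n → Fin n → ℝ) : Prop :=
  ∃ c : Fin n, ∀ v : Fin n, ∃ k, ReachIn (DPersistent n W) k c v

/-- Global agreement for the discrete-time evolution. -/
def DAgree (n : ℕ) (W : ℕ → Fin n → Fin n → ℝ) : Prop :=
  ∀ t0 : ℕ, ∀ x : ℕ → Fin n → ℝ, DTraj n W t0 x → Tendsto (dH n x) atTop (nhds 0)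

/-- Global ε-agreement for the discrete-time evolution. -/
def DEpsAgree (n : ℕ) (W : ℕ → Fin n → Fin n → ℝ) : Prop :=
  ∃ ε : ℝ, 0 < ε ∧ ε < 1 ∧ ∃ T0 : ℕ, 1 ≤ T0 ∧
    ∀ t0 : ℕ, ∀ x : ℕ → Fin n → ℝ, DTraj n W t0 x →
      ∀ t, t0 ≤ t → dH n x (t + T0) ≤ ε * dH n x t

/-- Condition (b): uniformly positive weight sums over windows of length `T` for persistent arcs. -/
def DArcCond (n : ℕ) (W : ℕ → Fin n → Fin n → ℝ) : Prop :=
  ∃ a : ℝ, 0 < a ∧ ∃ T : ℕ, 1 ≤ T ∧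
    ∀ t : ℕ, ∀ j i : Fin n, DPersistent n W j i →
      a ≤ ∑ s ∈ Finset.Ico t (t + T), W s i j

/-- ξ⁺(t;m) = ∑_{j ≠ m} W_mj(t). -/
def dXi (n : ℕ) (W : ℕ → Fin n → Fin n → ℝ) (t : ℕ) (m : Fin n) : ℝ :=
  ∑ j ∈ Finset.univ.erase m, W t m j


section helpers
variable {n : ℕ} {W : ℕ → Fin n → Fin n → ℝ}

lemma aux_nonneg (hW0 : ∀ t i j, 0 ≤ W t i j) {t0 : ℕ} {y : ℕ → Fin n → ℝ}
    (hy : DTraj n W t0 y) {t : ℕ} (ht : t0 ≤ t) (h0 : ∀ i, 0 ≤ y t i) (k : ℕ) :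
    ∀ i, 0 ≤ y (t + k) i := by
  induction k with
  | zero => simpa using h0
  | succ k ih =>
    intro i
    rw [← add_assoc, hy (t + k) (by omega) i]
    exact Finset.sum_nonneg fun j _ => mul_nonneg (hW0 _ _ _) (ih j)

lemma aux_step (hW0 : ∀ t i j, 0 ≤ W t i j) {t0 : ℕ} {y : ℕ → Fin n → ℝ}
    (hy : DTraj n W t0 y) {t : ℕ} (ht : t0 ≤ t) (h0 : ∀ i, 0 ≤ y t i) (i j : Fin n) :
    W t i j * y t j ≤ y (t + 1) i := by
  rw [hy t ht i]
  exact Finset.single_le_sum (f := fun j => W t i j * y t j)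
    (fun j _ => mul_nonneg (hW0 _ _ _) (h0 j)) (Finset.mem_univ j)

lemma aux_self (hW0 : ∀ t i j, 0 ≤ W t i j) {η : ℝ} (hη0 : 0 < η)
    (hA2 : ∀ t i, η ≤ W t i i) {t0 : ℕ} {y : ℕ → Fin n → ℝ}
    (hy : DTraj n W t0 y) {t : ℕ} (ht : t0 ≤ t) (h0 : ∀ i, 0 ≤ y t i) (i : Fin n) (k : ℕ) :
    η ^ k * y t i ≤ y (t + k) i := by
  induction k with
  | zero => simp
  | succ k ih =>
    have hn := aux_nonneg hW0 hy ht h0 k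
    have h1 := aux_step hW0 hy (t := t + k) (by omega) hn i i
    calc η ^ (k + 1) * y t i = η * (η ^ k * y t i) := by ring
      _ ≤ η * y (t + k) i := by gcongr
      _ ≤ W (t + k) i i * y (t + k) i := mul_le_mul_of_nonneg_right (hA2 _ _) (hn i)
      _ ≤ _ := h1

lemma aux_arc (hW0 : ∀ t i j, 0 ≤ W t i j) {η : ℝ} (hη0 : 0 < η) (hη1 : η < 1)
    (hA2 : ∀ t i, η ≤ W t i i) {a : ℝ} (ha : 0 < a) {T : ℕ} (hT : 1 ≤ T)
    (harc : ∀ t : ℕ, ∀ j i : Fin n, DPersistent n W j i →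
      a ≤ ∑ s ∈ Finset.Ico t (t + T), W s i j) {t0 : ℕ} {y : ℕ → Fin n → ℝ}
    (hy : DTraj n W t0 y) {t : ℕ} (ht : t0 ≤ t) (h0 : ∀ i, 0 ≤ y t i) (i j : Fin n)
    (hp : DPersistent n W j i) :
    (a / T) * η ^ T * y t j ≤ y (t + T) i := by
  have hT' : (0 : ℝ) < T := by exact_mod_cast hT
  obtain ⟨s, hs, hb⟩ : ∃ s ∈ Finset.Ico t (t + T), a / T ≤ W s i j := by
    by_contra! hcon
    have h1 : ∑ s ∈ Finset.Ico t (t + T), W s i j < ∑ s ∈ Finset.Ico t (t + T), a / T :=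
      Finset.sum_lt_sum_of_nonempty (by simp; omega) hcon
    have h2 := harc t j i hp
    simp at h1
    rw [mul_div_cancel₀ _ hT'.ne'] at h1
    linarith
  rw [Finset.mem_Ico] at hs
  obtain ⟨k, rfl⟩ := Nat.exists_eq_add_of_le hs.1
  obtain ⟨m, hm⟩ := Nat.exists_eq_add_of_le (show k + 1 ≤ T by omega)
  have n1 := aux_nonneg hW0 hy ht h0 k
  have n2 := aux_nonneg hW0 hy ht h0 (k + 1)
  have e1 := aux_self hW0 hη0 hA2 hy ht h0 j k
  have e2 := aux_step hW0 hy (t := t + k) (by omega) n1 i j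
  have e3 := aux_self hW0 hη0 hA2 hy (t := t + (k + 1)) (by omega) n2 i m
  have hyT : y (t + T) i = y (t + (k + 1) + m) i := by rw [hm, ← add_assoc]
  rw [hyT]
  have hab : 0 < a / T := by positivity
  have hle : η ^ T ≤ η ^ m * η ^ k := by
    rw [← pow_add]; exact pow_le_pow_of_le_one hη0.le hη1.le (by omega)
  calc a / T * η ^ T * y t j ≤ a / T * (η ^ m * η ^ k) * y t j := by
        have := h0 j
        gcongr
    _ = η ^ m * ((a / T) * (η ^ k * y t j)) := by ring
    _ ≤ η ^ m * ((a / T) * y (t + k) j) := by gcongr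
    _ ≤ η ^ m * (W (t + k) i j * y (t + k) j) := by
        have := n1 j
        gcongr
    _ ≤ η ^ m * y (t + (k + 1)) i := by gcongr; exact e2
    _ ≤ _ := e3

lemma aux_path (hW0 : ∀ t i j, 0 ≤ W t i j) {η : ℝ} (hη0 : 0 < η) (hη1 : η < 1)
    (hA2 : ∀ t i, η ≤ W t i i) {a : ℝ} (ha : 0 < a) {T : ℕ} (hT : 1 ≤ T)
    (harc : ∀ t : ℕ, ∀ j i : Fin n, DPersistent n W j i →
      a ≤ ∑ s ∈ Finset.Ico t (t + T), W s i j) {t0 : ℕ} {y : ℕ → Fin n → ℝ}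
    (hy : DTraj n W t0 y) (γ : ℝ) (hγ0 : 0 < γ) (hγ1 : γ ≤ (a / T) * η ^ T) (hγ2 : γ ≤ η ^ T)
    (v : Fin n) (N : ℕ) :
    ∀ (k : ℕ) (c : Fin n) (t : ℕ), k ≤ N → ReachIn (DPersistent n W) k c v → t0 ≤ t →
      (∀ i, 0 ≤ y t i) → γ ^ N * y t c ≤ y (t + N * T) v := by
  induction N with
  | zero =>
    intro k c t hk hr ht h0
    obtain rfl : k = 0 := by omega
    obtain rfl : c = v := hr
    simp
  | succ N ih =>
    intro k c t hk hr ht h0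
    have n1 := aux_nonneg hW0 hy ht h0 T
    have hc := h0 c
    have hN : t + (N + 1) * T = t + T + N * T := by ring
    have key : ∃ k' m, k' ≤ N ∧ ReachIn (DPersistent n W) k' m v ∧ γ * y t c ≤ y (t + T) m := by
      cases k with
      | zero =>
        exact ⟨0, c, by omega, hr, (mul_le_mul_of_nonneg_right hγ2 hc).trans
          (aux_self hW0 hη0 hA2 hy ht h0 c T)⟩
      | succ k =>
        obtain ⟨m, hm, hr'⟩ := hr
        exact ⟨k, m, by omega, hr', (mul_le_mul_of_nonneg_right hγ1 hc).trans
          (aux_arc hW0 hη0 hη1 hA2 ha hT harc hy ht h0 m c hm)⟩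
    obtain ⟨k', m, hk', hr', hle⟩ := key
    rw [hN]
    calc γ ^ (N + 1) * y t c = γ ^ N * (γ * y t c) := by ring
      _ ≤ γ ^ N * y (t + T) m := by gcongr
      _ ≤ _ := ih k' m (t + T) hk' hr' (by omega) n1

end helpers

/-- Under A1 and A2, quasi-strong connectivity of the persistent graph together
with condition (b) implies global ε-agreement. -/
theorem discrete_sufficiency_eps_agreement
    (n : ℕ) (hn : 2 ≤ n) (W : ℕ → Fin n → Fin n → ℝ)
    (hW0 : ∀ t i j, 0 ≤ W t i j)
    (hA1 : ∀ t i, ∑ j, W t i j = 1)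
    (η : ℝ) (hη0 : 0 < η) (hη1 : η < 1)
    (hA2 : ∀ t i, η ≤ W t i i)
    (hQSC : DQSC n W)
    (harc : DArcCond n W) :
    DEpsAgree n W := by
  obtain ⟨c, hc⟩ := hQSC
  obtain ⟨a, ha, T, hT, harc⟩ := harc
  choose k hk using hc
  have hT' : (0 : ℝ) < T := by exact_mod_cast hT
  set N := (∑ v, k v) + 1 with hN
  set γ := min ((a / T) * η ^ T) (η ^ T) with hγ
  have hγ0 : 0 < γ := lt_min (by positivity) (by positivity)
  have hγ1 : γ < 1 := (min_le_right _ _).trans_lt (pow_lt_one₀ hη0.le hη1 (by omega))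
  have hkN : ∀ v, k v ≤ N := fun v =>
    (Finset.single_le_sum (f := k) (fun _ _ => Nat.zero_le _) (Finset.mem_univ v)).trans
      (Nat.le_succ _)
  have hδ0 : 0 < γ ^ N := by positivity
  have hδ1 : γ ^ N < 1 := pow_lt_one₀ hγ0.le hγ1 (by omega)
  have : Nonempty (Fin n) := ⟨c⟩
  refine ⟨1 - γ ^ N, by linarith, by linarith, N * T, Nat.mul_pos (by omega) hT, ?_⟩
  intro t0 x hx t ht
  have hmax : ∀ i, x t i ≤ dMax n x t := fun i => le_ciSup (Finite.bddAbove_range (x t)) i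
  have hmin : ∀ i, dMin n x t ≤ x t i := fun i => ciInf_le (Finite.bddBelow_range (x t)) i
  have hy1 : DTraj n W t0 (fun s i => x s i - dMin n x t) := by
    intro s hs i
    simp only [hx s hs i, mul_sub, Finset.sum_sub_distrib, ← Finset.sum_mul, hA1, one_mul]
  have hy2 : DTraj n W t0 (fun s i => dMax n x t - x s i) := by
    intro s hs i
    simp only [hx s hs i, mul_sub, Finset.sum_sub_distrib, ← Finset.sum_mul, hA1, one_mul]
  have l1 := fun v => aux_path hW0 hη0 hη1 hA2 ha hT harc hy1 γ hγ0 (min_le_left _ _)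
    (min_le_right _ _) v N (k v) c t (hkN v) (hk v) ht (fun i => sub_nonneg.2 (hmin i))
  have l2 := fun v => aux_path hW0 hη0 hη1 hA2 ha hT harc hy2 γ hγ0 (min_le_left _ _)
    (min_le_right _ _) v N (k v) c t (hkN v) (hk v) ht (fun i => sub_nonneg.2 (hmax i))
  have u1 : dMax n x (t + N * T) ≤ dMax n x t - γ ^ N * (dMax n x t - x t c) :=
    ciSup_le fun v => by have := l2 v; linarith
  have u2 : dMin n x t + γ ^ N * (x t c - dMin n x t) ≤ dMin n x (t + N * T) :=
    le_ciInf fun v => by have := l1 v; linarith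
  unfold dH
  linarith
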